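/- arXiv:1805.06176 — 3 statements merged into one kernel-verified Lean document; each statement's English description precedes it below -/
import Mathlib

section
/- Let d ≥ 3 and 0 ≤ j ≤ ⌊3(d−1)/2⌋. Then the dimension over ℚ of the kernel of E restricted to V_j(d) (that is, dim {P ∈ V_j(d) : E(P) = 0}) equals j+1 if 0 ≤ j ≤ d−1, and equals 3d−2−2j if d ≤ j ≤ ⌊3(d−1)/2⌋. -/
open MvPolynomial

/-- The degree-`j` component of `ℚ[x₁,x₂,x₃]/(x₁^d,x₂^d,x₃^d)`, realized as the span of
the monomials of degree `j` with all exponents at most `d - 1`. -/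
noncomputable def Vspace (d j : ℕ) : Submodule ℚ (MvPolynomial (Fin 3) ℚ) :=
  Submodule.span ℚ {P | ∃ a : Fin 3 →₀ ℕ,
    (∀ i, a i ≤ d - 1) ∧ (∑ i, a i = j) ∧ P = monomial a 1}

/-- The lowering operator `E = Σ_k ((d−1)·∂_k − x_k·∂_k²)`. -/
noncomputable def Eop (d : ℕ) : MvPolynomial (Fin 3) ℚ →ₗ[ℚ] MvPolynomial (Fin 3) ℚ :=
  ∑ k : Fin 3,
    (((d : ℚ) - 1) • (pderiv k).toLinearMap
      - (LinearMap.mulLeft ℚ (X k)).comp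
          ((pderiv k).toLinearMap.comp (pderiv k).toLinearMap))

namespace EKer

/-- weight of a single exponent -/
def w1 (d n : ℕ) : ℚ := (n.factorial : ℚ) * ((d - 1).descFactorial n : ℚ)

lemma w1_succ (d n : ℕ) (hd : 1 ≤ d) :
    w1 d (n + 1) = ((n : ℚ) + 1) * ((d : ℚ) - 1 - n) * w1 d n := by
  unfold w1
  rw [Nat.factorial_succ, Nat.descFactorial_succ]
  by_cases h : n ≤ d - 1
  · push_cast [Nat.cast_sub h, Nat.cast_sub hd]; ring
  · have : (d - 1).descFactorial n = 0 := Nat.descFactorial_eq_zero_iff_lt.2 (by omega)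
    rw [this]; simp

/-- weight of a monomial -/
def w (d : ℕ) (a : Fin 3 →₀ ℕ) : ℚ := ∏ i, w1 d (a i)

lemma w_nonneg (d : ℕ) (a : Fin 3 →₀ ℕ) : 0 ≤ w d a :=
  Finset.prod_nonneg fun i _ => by unfold w1; positivity

lemma w_pos (d : ℕ) (a : Fin 3 →₀ ℕ) (h : ∀ i, a i ≤ d - 1) : 0 < w d a := by
  refine Finset.prod_pos fun i _ => ?_
  unfold w1
  have h1 : 0 < (d - 1).descFactorial (a i) := Nat.descFactorial_pos.2 (h i)
  have := Nat.factorial_pos (a i)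
  positivity

lemma w_zero (d : ℕ) (a : Fin 3 →₀ ℕ) (i : Fin 3) (h : d - 1 < a i) : w d a = 0 := by
  refine Finset.prod_eq_zero (Finset.mem_univ i) ?_
  simp [w1, Nat.descFactorial_eq_zero_iff_lt.2 h]

lemma w_add (d : ℕ) (hd : 1 ≤ d) (a : Fin 3 →₀ ℕ) (k : Fin 3) :
    w d (a + Finsupp.single k 1) = ((a k : ℚ) + 1) * ((d : ℚ) - 1 - a k) * w d a := by
  unfold w
  fin_cases k <;> simp [Fin.prod_univ_three, Finsupp.single_apply, w1_succ d _ hd] <;> ring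

/-- the box of exponents -/
noncomputable def box (d : ℕ) : Finset (Fin 3 →₀ ℕ) :=
  Finset.Iic (Finsupp.equivFunOnFinite.symm fun _ => d - 1)

lemma mem_box (d : ℕ) (a : Fin 3 →₀ ℕ) : a ∈ box d ↔ ∀ i, a i ≤ d - 1 := by
  simp [box, Finsupp.le_def]

/-- the bilinear form -/
noncomputable def B (d : ℕ) (p q : MvPolynomial (Fin 3) ℚ) : ℚ :=
  ∑ a ∈ box d, w d a * (coeff a p * coeff a q)

lemma B_add_left (d p p' q) : B d (p + p') q = B d p q + B d p' q := by
  simp only [B, coeff_add, ← Finset.sum_add_distrib]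
  exact Finset.sum_congr rfl fun _ _ => by ring

lemma B_add_right (d p q q') : B d p (q + q') = B d p q + B d p q' := by
  simp only [B, coeff_add, ← Finset.sum_add_distrib]
  exact Finset.sum_congr rfl fun _ _ => by ring

lemma B_smul_right (d p q) (c : ℚ) : B d p (c • q) = c * B d p q := by
  simp only [B, coeff_smul, Finset.mul_sum, smul_eq_mul]
  exact Finset.sum_congr rfl fun _ _ => by ring

lemma B_comm (d p q) : B d p q = B d q p := by
  simp only [B]
  exact Finset.sum_congr rfl fun _ _ => by ring

lemma B_nonneg (d p) : 0 ≤ B d p p :=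
  Finset.sum_nonneg fun a _ => mul_nonneg (w_nonneg d a) (mul_self_nonneg _)

lemma B_monomial (d : ℕ) (a b : Fin 3 →₀ ℕ) (r s : ℚ) :
    B d (monomial a r) (monomial b s) = if a = b then w d a * (r * s) else 0 := by
  classical
  unfold B
  simp only [coeff_monomial]
  split_ifs with h
  · subst h
    by_cases ha : a ∈ box d
    · rw [Finset.sum_eq_single_of_mem a ha]
      · simp
      · intro b _ hb; simp [hb.symm]
    · rw [Finset.sum_eq_zero]
      · rw [mem_box] at ha; push Not at ha
        obtain ⟨i, hi⟩ := ha
        simp [w_zero d a i hi]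
      · intro b hb
        have : a ≠ b := fun h => ha (h ▸ hb)
        simp [this]
  · refine Finset.sum_eq_zero fun c _ => ?_
    by_cases h1 : a = c
    · have : b ≠ c := fun h2 => h (h1.trans h2.symm)
      simp [this]
    · simp [h1]

/-- one summand of E -/
noncomputable def Ek (d : ℕ) (k : Fin 3) (p : MvPolynomial (Fin 3) ℚ) :
    MvPolynomial (Fin 3) ℚ := ((d : ℚ) - 1) • pderiv k p - X k * pderiv k (pderiv k p)

lemma Eop_apply (d p) : Eop d p = ∑ k, Ek d k p := by
  simp [Eop, Ek, LinearMap.sum_apply]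

lemma Ek_monomial (d : ℕ) (k : Fin 3) (a : Fin 3 →₀ ℕ) (r : ℚ) :
    Ek d k (monomial a r) =
      monomial (a - Finsupp.single k 1) ((a k : ℚ) * ((d : ℚ) - a k) * r) := by
  unfold Ek
  rw [pderiv_monomial, pderiv_monomial, X, monomial_mul, smul_monomial]
  rcases Nat.lt_or_ge (a k) 2 with h | h
  · have h2 : a k = 0 ∨ a k = 1 := by omega
    rcases h2 with h2 | h2
    · simp [h2]
    · simp [h2, mul_comm]
  · have : Finsupp.single k 1 + (a - Finsupp.single k 1 - Finsupp.single k 1)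
        = a - Finsupp.single k 1 := by
      ext i
      simp only [Finsupp.add_apply, Finsupp.tsub_apply, Finsupp.single_apply]
      split_ifs with hi
      · subst hi; omega
      · omega
    rw [this, ← map_sub]
    congr 1
    simp only [Finsupp.tsub_apply, Finsupp.single_eq_same]
    rw [Nat.cast_sub (by omega)]
    simp; ring

lemma adj_k (d : ℕ) (hd : 1 ≤ d) (k : Fin 3) (a b : Fin 3 →₀ ℕ) (r s : ℚ) :
    B d (X k * monomial a r) (monomial b s) = B d (monomial a r) (Ek d k (monomial b s)) := by
  rw [Ek_monomial, X, monomial_mul, B_monomial, B_monomial, one_mul]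
  by_cases hb : b k = 0
  · have : Finsupp.single k 1 + a ≠ b := by
      intro h; have := DFunLike.congr_fun h k; simp [hb] at this
    simp [this, hb]
  · have : (Finsupp.single k 1 + a = b) ↔ (a = b - Finsupp.single k 1) := by
      constructor
      · rintro rfl; simp
      · rintro rfl
        rw [add_tsub_cancel_of_le]
        rw [Finsupp.single_le_iff]; omega
    by_cases h : Finsupp.single k 1 + a = b
    · rw [if_pos h, if_pos (this.1 h)]
      subst h
      rw [add_comm, w_add d hd]
      simp; ring
    · rw [if_neg h, if_neg (fun h' => h (this.2 h'))]

/-- multiplication by the sum of variables -/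
noncomputable def F (p : MvPolynomial (Fin 3) ℚ) : MvPolynomial (Fin 3) ℚ := (∑ k, X k) * p

lemma F_add (p q) : F (p + q) = F p + F q := mul_add _ _ _

lemma adj (d : ℕ) (hd : 1 ≤ d) (p q) : B d (F p) q = B d p (Eop d q) := by
  induction p using MvPolynomial.induction_on' with
  | add p p' hp hp' => rw [F_add, B_add_left, B_add_left, hp, hp']
  | monomial a r =>
    induction q using MvPolynomial.induction_on' with
    | add q q' hq hq' => rw [map_add, B_add_right, B_add_right, hq, hq']
    | monomial b s =>
      rw [F, Eop_apply]
      simp only [Fin.sum_univ_three, add_mul, B_add_left, B_add_right, adj_k d hd]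

lemma comm (d : ℕ) (p : MvPolynomial (Fin 3) ℚ) :
    Eop d (F p) = F (Eop d p) + (3 * ((d : ℚ) - 1)) • p - (2 : ℚ) • ∑ k, X k * pderiv k p := by
  have h01 : (0 : Fin 3) ≠ 1 := by decide
  have h02 : (0 : Fin 3) ≠ 2 := by decide
  have h12 : (1 : Fin 3) ≠ 2 := by decide
  simp only [Eop_apply, F, Ek, Fin.sum_univ_three, add_mul, map_add, Derivation.leibniz,
    pderiv_X_self, pderiv_X_of_ne h01, pderiv_X_of_ne h02, pderiv_X_of_ne h12,
    pderiv_X_of_ne h01.symm, pderiv_X_of_ne h02.symm, pderiv_X_of_ne h12.symm, smul_eq_mul,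
    MvPolynomial.smul_eq_C_mul, map_zero, map_one, map_mul, map_sub, mul_zero, mul_one, add_zero]
  have e2 : (C (2 : ℚ) : MvPolynomial (Fin 3) ℚ) = 2 := map_ofNat C 2
  have e3 : (C (3 : ℚ) : MvPolynomial (Fin 3) ℚ) = 3 := map_ofNat C 3
  simp only [e2, e3, Derivation.map_one_eq_zero]
  ring

/-- truncated index set -/
def T (d j : ℕ) : Finset (ℕ × ℕ) :=
  (Finset.range d ×ˢ Finset.range d).filter fun x => x.1 + x.2 ≤ j ∧ j < x.1 + x.2 + d

/-- exponent from an index -/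
noncomputable def expo (j : ℕ) (x : ℕ × ℕ) : Fin 3 →₀ ℕ :=
  Finsupp.equivFunOnFinite.symm ![x.1, x.2, j - x.1 - x.2]

lemma expo_inj (j : ℕ) : Function.Injective (expo j) := by
  intro x y h
  have h0 := DFunLike.congr_fun h 0
  have h1 := DFunLike.congr_fun h 1
  simp [expo] at h0 h1
  exact Prod.ext h0 h1

lemma Vspace_eq (d j : ℕ) (hd : 1 ≤ d) :
    Vspace d j = Submodule.span ℚ
      (Set.range fun x : T d j => (monomial (expo j x.1) (1 : ℚ))) := by
  unfold Vspace
  congr 1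
  ext P
  simp only [Set.mem_ofPred_eq, Set.mem_range, Subtype.exists, Prod.exists]
  constructor
  · rintro ⟨a, ha, hs, rfl⟩
    rw [Fin.sum_univ_three] at hs
    have h0 := ha 0
    have h1 := ha 1
    have h2 := ha 2
    refine ⟨a 0, a 1, ?_, ?_⟩
    · simp only [T, Finset.mem_filter, Finset.mem_product, Finset.mem_range]; omega
    · have he : expo j (a 0, a 1) = a := by
        ext i
        fin_cases i <;> simp [expo]
        omega
      rw [he]
  · rintro ⟨x, y, h, rfl⟩
    simp only [T, Finset.mem_filter, Finset.mem_product, Finset.mem_range] at h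
    refine ⟨expo j (x, y), ?_, ?_, rfl⟩
    · intro i
      fin_cases i <;> simp [expo] <;> omega
    · simp [Fin.sum_univ_three, expo]; omega

lemma finrank_V (d j : ℕ) (hd : 1 ≤ d) : Module.finrank ℚ (Vspace d j) = (T d j).card := by
  rw [Vspace_eq d j hd, finrank_span_eq_card]
  · simp
  · have h := (basisMonomials (Fin 3) ℚ).linearIndependent
    rw [coe_basisMonomials] at h
    exact h.comp (fun x : T d j => expo j x.1) ((expo_inj j).comp Subtype.val_injective)

lemma finite_V (d j : ℕ) (hd : 1 ≤ d) : Module.Finite ℚ (Vspace d j) := by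
  rw [Vspace_eq d j hd]
  exact FiniteDimensional.span_of_finite ℚ (Set.finite_range _)

lemma monomial_mem (d j : ℕ) (a : Fin 3 →₀ ℕ) (r : ℚ) (h : ∀ i, a i ≤ d - 1)
    (hs : ∑ i, a i = j) : monomial a r ∈ Vspace d j := by
  have : monomial a r = r • (monomial a (1 : ℚ)) := by simp [smul_monomial]
  rw [this]
  exact Submodule.smul_mem _ _ (Submodule.subset_span ⟨a, h, hs, rfl⟩)

lemma E_mem (d j : ℕ) (p) (hp : p ∈ Vspace d (j + 1)) : Eop d p ∈ Vspace d j := by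
  suffices h : Vspace d (j + 1) ≤ (Vspace d j).comap (Eop d) from h hp
  unfold Vspace
  rw [Submodule.span_le]
  rintro _ ⟨a, ha, hs, rfl⟩
  change Eop d (monomial a 1) ∈ Vspace d j
  rw [Eop_apply]
  refine Submodule.sum_mem _ fun k _ => ?_
  rw [Ek_monomial]
  by_cases hk : a k = 0
  · simp [hk]
  · apply monomial_mem
    · intro i
      have := ha i
      simp only [Finsupp.tsub_apply]; omega
    · rw [Fin.sum_univ_three] at hs ⊢
      fin_cases k <;> simp [Finsupp.single_apply] at hk ⊢ <;> omega

lemma homog (d j : ℕ) (p) (hp : p ∈ Vspace d j) : p.IsHomogeneous j := by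
  rw [← mem_homogeneousSubmodule]
  suffices h : Vspace d j ≤ homogeneousSubmodule (Fin 3) ℚ j from h hp
  unfold Vspace
  rw [Submodule.span_le]
  rintro _ ⟨a, ha, hs, rfl⟩
  refine isHomogeneous_monomial _ ?_
  rw [← hs, Finsupp.degree_eq_sum]

lemma B_pos (d j : ℕ) (p) (hp : p ∈ Vspace d j) (h : B d p p ≤ 0) : p = 0 := by
  have h0 : B d p p = 0 := le_antisymm h (B_nonneg d p)
  unfold B at h0
  rw [Finset.sum_eq_zero_iff_of_nonneg
    (fun a _ => mul_nonneg (w_nonneg d a) (mul_self_nonneg _))] at h0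
  ext a
  rw [coeff_zero]
  by_cases ha : a ∈ box d
  · have h1 := h0 a ha
    have := w_pos d a ((mem_box d a).1 ha)
    simpa [this.ne'] using h1
  · have hV : Vspace d j ≤ LinearMap.ker (lcoeff ℚ a) := by
      unfold Vspace
      rw [Submodule.span_le]
      rintro _ ⟨b, hb, hs, rfl⟩
      have : b ≠ a := fun h => ha (h ▸ (mem_box d b).2 hb)
      classical
      simp [coeff_monomial, this]
    simpa using hV hp

lemma surj (d j : ℕ) (hd : 1 ≤ d) (hj : 2 * j < 3 * (d - 1)) :
    (Vspace d (j + 1)).map (Eop d) = Vspace d j := by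
  apply le_antisymm
  · rintro _ ⟨p, hp, rfl⟩
    exact E_mem d j p hp
  intro x hx
  by_contra hnot
  obtain ⟨f, hfx, hf⟩ := Submodule.exists_le_ker_of_notMem hnot
  set S := (box d).filter fun a => ∑ i, a i = j with hS
  set u : MvPolynomial (Fin 3) ℚ := ∑ a ∈ S, monomial a (f (monomial a 1) / w d a) with hu
  have huV : u ∈ Vspace d j := by
    refine Submodule.sum_mem _ fun a ha => ?_
    rw [hS, Finset.mem_filter, mem_box] at ha
    exact monomial_mem d j a _ ha.1 ha.2
  have hBu : ∀ q ∈ Vspace d j, B d u q = f q := by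
    intro q hq
    induction hq using Submodule.span_induction with
    | mem q hq =>
      obtain ⟨b, hb, hs, rfl⟩ := hq
      have hbS : b ∈ S := by rw [hS, Finset.mem_filter, mem_box]; exact ⟨hb, hs⟩
      have hc : ∀ a, coeff a u = if a ∈ S then f (monomial a 1) / w d a else 0 := by
        intro a
        classical
        rw [hu, coeff_sum]
        simp [coeff_monomial]
      classical
      unfold B
      rw [Finset.sum_eq_single_of_mem b ((mem_box d b).2 hb)]
      · rw [hc, if_pos hbS]
        have := (w_pos d b hb).ne'
        simp [coeff_monomial]; field_simp
      · intro c _ hcb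
        simp [coeff_monomial, hcb.symm]
    | zero => simp [B]
    | add p q _ _ hp hq => rw [B_add_right, hp, hq, map_add]
    | smul c p _ hp => rw [B_smul_right, hp, map_smul, smul_eq_mul]
  -- `F u` is orthogonal to everything in degree `j+1`, hence to itself
  have hFu : ∀ q : MvPolynomial (Fin 3) ℚ, q.IsHomogeneous (j + 1) → B d (F u) q = 0 := by
    intro q hq
    rw [q.as_sum]
    have : ∀ s : Finset (Fin 3 →₀ ℕ), s ⊆ q.support →
        B d (F u) (∑ v ∈ s, monomial v (coeff v q)) = 0 := by
      intro s
      classical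
      induction s using Finset.induction_on with
      | empty => intro _; simp [B]
      | insert a s ha ih =>
        intro hsub
        rw [Finset.sum_insert ha, B_add_right,
          ih (fun x hx => hsub (Finset.mem_insert_of_mem hx)), add_zero]
        have hdeg : ∑ i, a i = j + 1 := by
          by_contra hne
          have hmem := hsub (Finset.mem_insert_self a s)
          rw [mem_support_iff] at hmem
          exact hmem (hq.coeff_eq_zero (by rwa [Finsupp.degree_eq_sum]))
        by_cases hab : ∀ i, a i ≤ d - 1
        · have hm := monomial_mem d (j + 1) a (coeff a q) hab hdeg
          rw [adj d hd, hBu _ (E_mem d j _ hm)]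
          exact hf ⟨_, hm, rfl⟩
        · unfold B
          refine Finset.sum_eq_zero fun c hc => ?_
          have : a ≠ c := fun h => hab (h ▸ (mem_box d c).1 hc)
          simp [coeff_monomial, this]
    exact this _ subset_rfl
  have huh := homog d j u huV
  have hFh : (F u).IsHomogeneous (j + 1) := by
    rw [add_comm]
    exact (IsHomogeneous.sum _ _ _ fun i _ => isHomogeneous_X _ _).mul huh
  have h1 := hFu (F u) hFh
  have hEu : B d u (F (Eop d u)) = B d (Eop d u) (Eop d u) := by
    rw [B_comm, adj d hd]
  have hcomm : Eop d (F u) = F (Eop d u) + (3 * ((d : ℚ) - 1) - 2 * j) • u := by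
    rw [comm, huh.sum_X_mul_pderiv, sub_smul, ← Nat.cast_smul_eq_nsmul ℚ, smul_smul]
    abel
  rw [adj d hd, hcomm, B_add_right, hEu, B_smul_right] at h1
  have hpos : (0 : ℚ) < 3 * ((d : ℚ) - 1) - 2 * j := by
    have : ((2 * j : ℕ) : ℚ) < ((3 * (d - 1) : ℕ) : ℚ) := by exact_mod_cast hj
    push_cast [Nat.cast_sub hd] at this
    linarith
  have hu0 : u = 0 := by
    apply B_pos d j u huV
    have h2 := B_nonneg d (Eop d u)
    by_contra h3
    push Not at h3
    have := mul_pos hpos h3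
    linarith
  apply hfx
  rw [← hBu x hx, hu0]
  simp [B]

lemma finrank_ker (d j : ℕ) (hd : 1 ≤ d) :
    Module.finrank ℚ ((Vspace d j).map (Eop d)) +
      Module.finrank ℚ ↥(Vspace d j ⊓ LinearMap.ker (Eop d)) = (T d j).card := by
  haveI := finite_V d j hd
  have h := LinearMap.finrank_range_add_finrank_ker ((Eop d).domRestrict (Vspace d j))
  rw [finrank_V d j hd, LinearMap.range_domRestrict, LinearMap.ker_domRestrict] at h
  rw [← h, ← Submodule.finrank_map_subtype_eq, Submodule.map_comap_subtype]

lemma card_T (d j : ℕ) :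
    (T d (j + 1)).card +
      ((Finset.range d ×ˢ Finset.range d).filter fun x => x.1 + x.2 + d = j + 1).card =
    (T d j).card +
      ((Finset.range d ×ˢ Finset.range d).filter fun x => x.1 + x.2 = j + 1).card := by
  rw [← Finset.card_union_of_disjoint, ← Finset.card_union_of_disjoint]
  · congr 1
    ext x
    simp only [T, Finset.mem_union, Finset.mem_filter, Finset.mem_product, Finset.mem_range]
    omega
  · rw [Finset.disjoint_left]
    intro x
    simp only [T, Finset.mem_filter, Finset.mem_product, Finset.mem_range]
    omega
  · rw [Finset.disjoint_left]
    intro x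
    simp only [T, Finset.mem_filter, Finset.mem_product, Finset.mem_range]
    omega

lemma card_line (d j : ℕ) :
    ((Finset.range d ×ˢ Finset.range d).filter fun x => x.1 + x.2 = j).card
      = (Finset.Ico (j + 1 - d) (min d (j + 1))).card := by
  symm
  refine Finset.card_bij (fun a _ => (a, j - a)) ?_ ?_ ?_
  · intro a ha
    simp only [Finset.mem_filter, Finset.mem_product, Finset.mem_range, Finset.mem_Ico] at *
    omega
  · intro a _ b _ h
    exact (Prod.ext_iff.1 h).1
  · rintro ⟨x, y⟩ h
    simp only [Finset.mem_filter, Finset.mem_product, Finset.mem_range] at h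
    refine ⟨x, ?_, ?_⟩
    · rw [Finset.mem_Ico]; omega
    · ext <;> simp; omega

lemma card_line_low (d j : ℕ) (h : j < d) :
    ((Finset.range d ×ˢ Finset.range d).filter fun x => x.1 + x.2 + d = j).card = 0 := by
  rw [Finset.card_eq_zero, Finset.filter_eq_empty_iff]
  intro x _; omega

lemma card_line_high (d j : ℕ) (h : d ≤ j) :
    ((Finset.range d ×ˢ Finset.range d).filter fun x => x.1 + x.2 + d = j).card
      = (Finset.Ico (j - d + 1 - d) (min d (j - d + 1))).card := by
  rw [← card_line]
  congr 1
  ext x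
  simp only [Finset.mem_filter]
  exact and_congr_right fun _ => by omega

lemma T_zero (d : ℕ) (hd : 1 ≤ d) : (T d 0).card = 1 := by
  rw [Finset.card_eq_one]
  refine ⟨(0, 0), ?_⟩
  ext ⟨x, y⟩
  simp only [T, Finset.mem_filter, Finset.mem_product, Finset.mem_range, Finset.mem_singleton,
    Prod.mk.injEq]
  omega

lemma map_zero_deg (d : ℕ) : (Vspace d 0).map (Eop d) = ⊥ := by
  rw [eq_bot_iff, Submodule.map_le_iff_le_comap]
  conv_lhs => unfold Vspace
  rw [Submodule.span_le]
  rintro _ ⟨a, ha, hs, rfl⟩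
  have h0 : ∀ i, a i = 0 := by simpa using hs
  simp [Eop_apply, Ek_monomial, h0]

end EKer

open EKer in
theorem stmt_0 (d j : ℕ) (hd : 3 ≤ d) (hj : j ≤ 3 * (d - 1) / 2) :
    (j ≤ d - 1 →
      Module.finrank ℚ ↥(Vspace d j ⊓ LinearMap.ker (Eop d)) = j + 1) ∧
    (d ≤ j →
      (Module.finrank ℚ ↥(Vspace d j ⊓ LinearMap.ker (Eop d)) : ℤ)
        = 3 * (d : ℤ) - 2 - 2 * (j : ℤ)) := by
  have hd1 : 1 ≤ d := by omega
  have hk := finrank_ker d j hd1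
  rcases j with _ | j
  · rw [map_zero_deg, finrank_bot, T_zero d hd1] at hk
    exact ⟨fun _ => by omega, fun h => by omega⟩
  · rw [surj d j hd1 (by omega), finrank_V d j hd1] at hk
    have hc := card_T d j
    rw [card_line, Nat.card_Ico] at hc
    constructor
    · intro h
      rw [card_line_low d (j + 1) (by omega)] at hc
      omega
    · intro h
      rw [card_line_high d (j + 1) h, Nat.card_Ico] at hc
      omega
end

section
/- Let d ≥ 3 and 1 ≤ j ≤ ⌊3(d−1)/2⌋. Then the operator E maps the subspace of S₃-invariant polynomials in V_j(d) surjectively onto the subspace of S₃-invariant polynomials in V_{j−1}(d). (Equivalently, the coefficient matrix C of the linear system E(P) = 0 for symmetric P of degree j has rank equal to its number of rows, namely the number of partitions of j−1 with at most 3 parts each at most d−1.) -/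
open MvPolynomial

lemma Eop_apply (d : ℕ) (P : MvPolynomial (Fin 3) ℚ) :
    Eop d P = ∑ k : Fin 3, (((d : ℚ) - 1) • pderiv k P - X k * pderiv k (pderiv k P)) := by
  simp [Eop]

/-- the sum of the variables -/
noncomputable def sX : MvPolynomial (Fin 3) ℚ := X 0 + X 1 + X 2

lemma sX_hom : sX.IsHomogeneous 1 :=
  ((isHomogeneous_X _ _).add (isHomogeneous_X _ _)).add (isHomogeneous_X _ _)

lemma sX_symm : sX.IsSymmetric := by
  have h : sX = ∑ i : Fin 3, X i := by simp [sX, Fin.sum_univ_three]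
  intro σ
  rw [h, map_sum]
  simp only [rename_X]
  exact Equiv.sum_comp σ (fun i => (X i : MvPolynomial (Fin 3) ℚ))

lemma Eop_symm (d : ℕ) {P : MvPolynomial (Fin 3) ℚ} (hP : P.IsSymmetric) :
    (Eop d P).IsSymmetric := by
  intro σ
  have h : ∀ (k : Fin 3) (Q : MvPolynomial (Fin 3) ℚ),
      rename σ (pderiv k Q) = pderiv (σ k) (rename σ Q) := fun k Q =>
    (pderiv_rename σ.injective k Q).symm
  rw [Eop_apply, map_sum]
  simp only [map_sub, map_smul, map_mul, rename_X, h, hP σ]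
  exact Equiv.sum_comp σ (fun k => ((d : ℚ) - 1) • pderiv k P - X k * pderiv k (pderiv k P))

lemma pderiv_hom_zero (k : Fin 3) {P : MvPolynomial (Fin 3) ℚ} (hP : P.IsHomogeneous 0) :
    pderiv k P = 0 := by
  rw [totalDegree_eq_zero_iff_eq_C.1 ((totalDegree_zero_iff_isHomogeneous _).2 hP), pderiv_C]

lemma Eop_hom (d n : ℕ) {P : MvPolynomial (Fin 3) ℚ} (hP : P.IsHomogeneous (n + 1)) :
    (Eop d P).IsHomogeneous n := by
  rw [Eop_apply]
  refine IsHomogeneous.sum _ _ _ fun k _ => ?_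
  have h1 : (pderiv k P).IsHomogeneous n := hP.pderiv
  refine IsHomogeneous.sub ?_ ?_
  · rw [smul_eq_C_mul]
    simpa using (isHomogeneous_C (Fin 3) ((d : ℚ) - 1)).mul h1
  · rcases n with _ | n
    · rw [pderiv_hom_zero k h1, mul_zero]
      exact isHomogeneous_zero _ _ _
    · have := (isHomogeneous_X ℚ k).mul (h1.pderiv (i := k))
      simpa [add_comm] using this

lemma Eop_hom_zero (d : ℕ) {P : MvPolynomial (Fin 3) ℚ} (hP : P.IsHomogeneous 0) :
    Eop d P = 0 := by
  rw [Eop_apply]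
  simp [pderiv_hom_zero _ hP]

lemma comm_one (d n : ℕ) {P : MvPolynomial (Fin 3) ℚ} (hP : P.IsHomogeneous n) :
    Eop d (sX * P) = sX * Eop d P + (3 * ((d : ℚ) - 1) - 2 * n) • P := by
  have hE := hP.sum_X_mul_pderiv
  have e : (3 * ((d : ℚ) - 1) - 2 * n) • P =
    C (3 * ((d : ℚ) - 1)) * P - 2 * ∑ i : Fin 3, X i * pderiv i P := by
    have h2 : (C 2 : MvPolynomial (Fin 3) ℚ) = 2 := map_ofNat C 2
    rw [hE, smul_eq_C_mul]; simp [h2]; ring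
  rw [e]
  simp only [Eop_apply, Fin.sum_univ_three, smul_eq_C_mul, sX, Derivation.leibniz, map_add,
    pderiv_X, Pi.single_apply, smul_eq_mul, map_mul]
  have h3 : (C 3 : MvPolynomial (Fin 3) ℚ) = 3 := map_ofNat C 3
  simp [h3]
  ring

lemma comm_pow (d n : ℕ) {P : MvPolynomial (Fin 3) ℚ} (hP : P.IsHomogeneous n) (k : ℕ) :
    Eop d (sX ^ (k + 1) * P) = sX ^ (k + 1) * Eop d P +
      (((k : ℚ) + 1) * (3 * ((d : ℚ) - 1) - 2 * n - k)) • (sX ^ k * P) := by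
  induction k with
  | zero => simpa using comm_one d n hP
  | succ k ih =>
    have h1 : (sX ^ (k + 1) * P).IsHomogeneous (1 * (k + 1) + n) := (sX_hom.pow _).mul hP
    have h2 := comm_one d _ h1
    rw [show sX ^ (k + 1 + 1) * P = sX * (sX ^ (k + 1) * P) by ring, h2, ih]
    simp only [smul_eq_C_mul]
    push_cast
    have h2 : (C 2 : MvPolynomial (Fin 3) ℚ) = 2 := map_ofNat C 2
    simp only [map_mul, map_sub, map_add, map_one, h2]
    ring

lemma surj_aux (d m : ℕ) (hm : 2 * (m : ℚ) < 3 * ((d : ℚ) - 1)) (n : ℕ) :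
    ∀ k, n + k = m → ∀ P : MvPolynomial (Fin 3) ℚ, P.IsHomogeneous n → P.IsSymmetric →
      ∃ R : MvPolynomial (Fin 3) ℚ, R.IsHomogeneous (m + 1) ∧ R.IsSymmetric ∧
        Eop d R = sX ^ k * P := by
  have key : ∀ (n k : ℕ), n + k = m → ∀ P R' : MvPolynomial (Fin 3) ℚ, P.IsHomogeneous n →
      P.IsSymmetric → R'.IsHomogeneous (m + 1) → R'.IsSymmetric →
      Eop d R' = sX ^ (k + 1) * Eop d P → 
      ∃ R : MvPolynomial (Fin 3) ℚ, R.IsHomogeneous (m + 1) ∧ R.IsSymmetric ∧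
        Eop d R = sX ^ k * P := by
    intro n k hk P R' hP hs hR' hRs hE
    set c : ℚ := ((k : ℚ) + 1) * (3 * ((d : ℚ) - 1) - 2 * n - k) with hc
    have hc0 : c ≠ 0 := by
      have : (n : ℚ) + k = m := by exact_mod_cast hk
      have h0 : (0 : ℚ) ≤ k := by positivity
      have : 0 < c := mul_pos (by linarith) (by linarith)
      exact this.ne'
    refine ⟨c⁻¹ • (sX ^ (k + 1) * P - R'), ?_, ?_, ?_⟩
    · rw [smul_eq_C_mul]
      have h1 : (sX ^ (k + 1) * P).IsHomogeneous (m + 1) := by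
        have := (sX_hom.pow (k + 1)).mul hP
        rwa [show 1 * (k + 1) + n = m + 1 by omega] at this
      simpa using (isHomogeneous_C (Fin 3) c⁻¹).mul (h1.sub hR')
    · intro σ
      simp only [map_smul, map_sub, map_mul, map_pow, sX_symm σ, hs σ, hRs σ]
    · rw [map_smul, map_sub, comm_pow d n hP, hE, add_sub_cancel_left, smul_smul,
        inv_mul_cancel₀ hc0, one_smul]
  induction n with
  | zero =>
    intro k hk P hP hs
    refine key 0 k hk P 0 hP hs (isHomogeneous_zero _ _ _) (fun σ => by simp) ?_
    rw [Eop_hom_zero d hP]; simp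
  | succ n ih =>
    intro k hk P hP hs
    obtain ⟨R', h1, h2, h3⟩ := ih (k + 1) (by omega) (Eop d P) (Eop_hom d n hP) (Eop_symm d hs)
    exact key (n + 1) k hk P R' hP hs h1 h2 h3

open Classical in
/-- truncation modulo the `d`-th powers of the variables -/
noncomputable def truncD (d : ℕ) : MvPolynomial (Fin 3) ℚ →ₗ[ℚ] MvPolynomial (Fin 3) ℚ :=
  (basisMonomials (Fin 3) ℚ).constr ℚ
    (fun a => if ∀ i, a i < d then monomial a (1 : ℚ) else 0)

open Classical in
lemma truncD_monomial (d : ℕ) (a : Fin 3 →₀ ℕ) (c : ℚ) :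
    truncD d (monomial a c) = if ∀ i, a i < d then monomial a c else 0 := by
  have h := (basisMonomials (Fin 3) ℚ).constr_basis ℚ
    (fun a => if ∀ i, a i < d then monomial a (1 : ℚ) else 0) a
  rw [coe_basisMonomials] at h
  have : monomial a c = c • monomial a (1 : ℚ) := by simp [smul_monomial]
  rw [this, map_smul]
  unfold truncD
  rw [h]
  split_ifs <;> simp

lemma Eop_monomial (d : ℕ) (a : Fin 3 →₀ ℕ) :
    Eop d (monomial a 1) = ∑ k : Fin 3,
      monomial (a - Finsupp.single k 1) ((a k : ℚ) * ((d : ℚ) - a k)) := by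
  rw [Eop_apply]
  refine Finset.sum_congr rfl fun k _ => ?_
  rw [pderiv_monomial, pderiv_monomial, X, monomial_mul, smul_monomial]
  rcases h : a k with _ | n
  · simp
  rcases n with _ | n
  · simp [h]
  · have : Finsupp.single k 1 + (a - Finsupp.single k 1 - Finsupp.single k 1) =
        a - Finsupp.single k 1 := by
      ext i
      by_cases hi : k = i
      · subst hi; simp [h]
      · simp [Finsupp.single_apply, hi]
    rw [this, ← map_sub]
    congr 1
    simp [h]
    ring

lemma truncD_Eop (d : ℕ) (P : MvPolynomial (Fin 3) ℚ) :
    truncD d (Eop d P) = Eop d (truncD d P) := by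
  have : (truncD d).comp (Eop d) = (Eop d).comp (truncD d) := by
    refine (basisMonomials (Fin 3) ℚ).ext fun a => ?_
    simp only [coe_basisMonomials, LinearMap.comp_apply]
    rw [truncD_monomial]
    split_ifs with h
    · rw [Eop_monomial, map_sum]
      refine Finset.sum_congr rfl fun k _ => ?_
      rw [truncD_monomial, if_pos]
      intro i
      exact lt_of_le_of_lt (by simp) (h i)
    · rw [Eop_monomial, map_sum, map_zero]
      refine Finset.sum_eq_zero fun k _ => ?_
      rw [truncD_monomial]
      split_ifs with h2
      · push Not at h
        obtain ⟨i, hi⟩ := h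
        have := h2 i
        by_cases hk : k = i
        · subst hk
          simp at this
          have : a k = d := by omega
          simp [this]
        · simp [Finsupp.single_apply, hk] at this
          omega
      · rfl
  exact LinearMap.congr_fun this P

lemma truncD_rename (d : ℕ) (σ : Equiv.Perm (Fin 3)) (P : MvPolynomial (Fin 3) ℚ) :
    rename σ (truncD d P) = truncD d (rename σ P) := by
  induction P using MvPolynomial.induction_on' with
  | monomial a c =>
    rw [rename_monomial, truncD_monomial, truncD_monomial]
    have : (∀ i, a i < d) ↔ ∀ i, (Finsupp.mapDomain σ a) i < d := by
      constructor
      · intro h i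
        obtain ⟨i, rfl⟩ := σ.surjective i
        rw [Finsupp.mapDomain_apply σ.injective]; exact h i
      · intro h i
        have := h (σ i)
        rwa [Finsupp.mapDomain_apply σ.injective] at this
    simp only [← this]
    split_ifs
    · rw [rename_monomial]
    · simp
  | add p q hp hq => simp only [map_add, hp, hq]

lemma truncD_of_mem (d j : ℕ) (hd : 1 ≤ d) {Q : MvPolynomial (Fin 3) ℚ} (hQ : Q ∈ Vspace d j) :
    truncD d Q = Q := by
  induction hQ using Submodule.span_induction with
  | mem x hx =>
    obtain ⟨a, h1, h2, rfl⟩ := hx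
    rw [truncD_monomial, if_pos]
    intro i
    have := h1 i
    omega
  | zero => simp
  | add x y _ _ hx hy => rw [map_add, hx, hy]
  | smul c x _ hx => rw [map_smul, hx]

lemma hom_of_mem (d j : ℕ) {Q : MvPolynomial (Fin 3) ℚ} (hQ : Q ∈ Vspace d j) :
    Q.IsHomogeneous j := by
  rw [← mem_homogeneousSubmodule]
  refine (Submodule.span_le.2 ?_) hQ
  rintro _ ⟨a, h1, h2, rfl⟩
  refine isHomogeneous_monomial _ ?_
  rw [Finsupp.degree_eq_sum, h2]

lemma truncD_mem (d j : ℕ) {P : MvPolynomial (Fin 3) ℚ} (hP : P.IsHomogeneous j) :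
    truncD d P ∈ Vspace d j := by
  rw [P.as_sum, map_sum]
  refine Submodule.sum_mem _ fun a ha => ?_
  rw [truncD_monomial]
  split_ifs with h
  · have : monomial a (coeff a P) = coeff a P • monomial a (1 : ℚ) := by simp [smul_monomial]
    rw [this]
    refine Submodule.smul_mem _ _ (Submodule.subset_span ⟨a, ?_, ?_, rfl⟩)
    · intro i
      have := h i
      omega
    · rw [← Finsupp.degree_eq_sum]
      by_contra hne
      exact (mem_support_iff.1 ha) (hP.coeff_eq_zero hne)
  · exact Submodule.zero_mem _

/-- `E` maps the `S₃`-invariant part of `V_j(d)` onto the `S₃`-invariant part of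
`V_{j-1}(d)`. -/
theorem stmt_2 (d j : ℕ) (hd : 3 ≤ d) (hj1 : 1 ≤ j) (hj : j ≤ 3 * (d - 1) / 2) :
    ∀ Q ∈ Vspace d (j - 1), Q.IsSymmetric →
      ∃ P ∈ Vspace d j, P.IsSymmetric ∧ Eop d P = Q := by
  intro Q hQ hs
  obtain ⟨m, rfl⟩ : ∃ m, j = m + 1 := ⟨j - 1, by omega⟩
  simp only [Nat.add_sub_cancel] at hQ
  have hm : 2 * (m : ℚ) < 3 * ((d : ℚ) - 1) := by
    have : 2 * m + 3 < 3 * d := by omega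
    have : 2 * (m : ℚ) + 3 < 3 * d := by exact_mod_cast this
    linarith
  obtain ⟨R, h1, h2, h3⟩ := surj_aux d m hm m 0 rfl Q (hom_of_mem d m hQ) hs
  refine ⟨truncD d R, truncD_mem d _ h1, fun σ => ?_, ?_⟩
  · rw [truncD_rename, h2 σ]
  · rw [← truncD_Eop, h3, pow_zero, one_mul, truncD_of_mem d m (by omega) hQ]
end

section
/- Let d ≥ 3 and 0 ≤ j ≤ ⌊3(d−1)/2⌋ with j ≠ 1. Then the number of integer triples (a,b,c) with d−1 ≥ a ≥ b ≥ c ≥ 0, a+b+c = j and a = b equals the number of integer triples (a,b,c) with d−1 ≥ a ≥ b ≥ c ≥ 0, a+b+c = j, a = b+2 and b ≥ c+2, plus one. -/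
theorem stmt_10 (d j : ℤ) (hd : 3 ≤ d) (hj0 : 0 ≤ j) (hj : j ≤ 3 * (d - 1) / 2)
    (hj1 : j ≠ 1) :
    ((Finset.Icc 0 (d - 1) ×ˢ Finset.Icc 0 (d - 1) ×ˢ Finset.Icc 0 (d - 1)).filter
      (fun t : ℤ × ℤ × ℤ => t.2.1 ≤ t.1 ∧ t.2.2 ≤ t.2.1 ∧ t.1 + t.2.1 + t.2.2 = j ∧
        t.1 = t.2.1)).card
    = ((Finset.Icc 0 (d - 1) ×ˢ Finset.Icc 0 (d - 1) ×ˢ Finset.Icc 0 (d - 1)).filter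
      (fun t : ℤ × ℤ × ℤ => t.2.1 ≤ t.1 ∧ t.2.2 ≤ t.2.1 ∧ t.1 + t.2.1 + t.2.2 = j ∧
        t.1 = t.2.1 + 2 ∧ t.2.2 + 2 ≤ t.2.1)).card + 1 := by
  have h1 : ((Finset.Icc 0 (d - 1) ×ˢ Finset.Icc 0 (d - 1) ×ˢ Finset.Icc 0 (d - 1)).filter
      (fun t : ℤ × ℤ × ℤ => t.2.1 ≤ t.1 ∧ t.2.2 ≤ t.2.1 ∧ t.1 + t.2.1 + t.2.2 = j ∧
        t.1 = t.2.1)) = (Finset.Icc ((j + 2) / 3) (j / 2)).image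
          (fun a : ℤ => (a, a, j - 2 * a)) := by
    ext ⟨a, b, c⟩
    simp only [Finset.mem_filter, Finset.mem_product, Finset.mem_Icc, Finset.mem_image,
      Prod.mk.injEq]
    constructor
    · intro h
      exact ⟨a, by omega, by omega, by omega, by omega⟩
    · rintro ⟨x, hx, h⟩
      omega
  have h2 : ((Finset.Icc 0 (d - 1) ×ˢ Finset.Icc 0 (d - 1) ×ˢ Finset.Icc 0 (d - 1)).filter
      (fun t : ℤ × ℤ × ℤ => t.2.1 ≤ t.1 ∧ t.2.2 ≤ t.2.1 ∧ t.1 + t.2.1 + t.2.2 = j ∧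
        t.1 = t.2.1 + 2 ∧ t.2.2 + 2 ≤ t.2.1)) = (Finset.Icc ((j + 2) / 3) (j / 2 - 1)).image
          (fun b : ℤ => (b + 2, b, j - 2 * b - 2)) := by
    ext ⟨a, b, c⟩
    simp only [Finset.mem_filter, Finset.mem_product, Finset.mem_Icc, Finset.mem_image,
      Prod.mk.injEq]
    constructor
    · intro h
      exact ⟨b, by omega, by omega, by omega, by omega⟩
    · rintro ⟨x, hx, h⟩
      omega
  rw [h1, h2, Finset.card_image_of_injective, Finset.card_image_of_injective,
    Int.card_Icc, Int.card_Icc]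
  · omega
  · intro x y h
    simp only [Prod.mk.injEq] at h
    exact h.2.1
  · intro x y h
    simp only [Prod.mk.injEq] at h
    exact h.1
end
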